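/- Let F be a field of characteristic ≠ 2 with pairwise distinct ζ₁,...,ζ₆. Consider the left-hand-side expression L(X) := ∫ W̃₁₂₃₄₅ W̃₁₂₃₄₆ W̃₁₂₃₅₆ w₁₂₃ (da₁₂₃₄ db₁₂₃₄/ζ₃₄)(da₁₂₃₅ db₁₂₃₅/ζ₃₅)(da₁₂₃₆ db₁₂₃₆/ζ₃₆) of the deformed 3→3 relation, where the deformations W̃_u = W_u + ε_u Σ_p x_{u,p} v_{u,p} are built from an x-chain X = (x_{u,p}). If X' is obtained from X by adding a boundary x-chain — i.e., an x-chain in the image of the map g₃ applied to a chain of the inner tetrahedra 1234, 1235, 1236 (g₃(e_t) = e_{u,m} + e_{u',m'} for the two 4-simplices u = t ∪ {m}, u' = t ∪ {m'} containing t) — then L(X') = L(X). -/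

import Mathlib

noncomputable section

variable (F : Type*) [Field F]

/-- Exterior (Grassmann) algebra on generators `a_t, b_t` indexed by tetrahedra
`t ⊂ {1,…,6}` (0-indexed as `Fin 6`). -/
abbrev Lam := ExteriorAlgebra F ((Bool × Finset (Fin 6)) → F)

/-- generator `a_t` -/
def av (t : Finset (Fin 6)) : Lam F := ExteriorAlgebra.ι F (Pi.single (false, t) 1)
/-- generator `b_t` -/
def bv (t : Finset (Fin 6)) : Lam F := ExteriorAlgebra.ι F (Pi.single (true, t) 1)

/-- `∂/∂a_t`. -/
def da (t : Finset (Fin 6)) : Lam F →ₗ[F] Lam F :=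
  CliffordAlgebra.contractLeft (LinearMap.proj (false, t))
/-- `∂/∂b_t`. -/
def db (t : Finset (Fin 6)) : Lam F →ₗ[F] Lam F :=
  CliffordAlgebra.contractLeft (LinearMap.proj (true, t))

/-- Berezin integral `∫ f da_t db_t`. -/
def int2 (t : Finset (Fin 6)) (f : Lam F) : Lam F := db F t (da F t f)

variable (ζ : Fin 6 → F)

/-- The degree-1 elements `v_{u,1},…,v_{u,5}` of `u = ijklm` (`i<j<k<l<m`). -/
def vv (i j k l m : Fin 6) : Fin 5 → Lam F :=
  let v1 : Lam F :=
    (ζ k - ζ l) • av F {i,j,k,l} - (ζ k - ζ m) • av F {i,j,k,m}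
      + (ζ l - ζ m) • av F {i,j,l,m} - (ζ l - ζ m) • av F {i,k,l,m}
  let v2 : Lam F :=
    (ζ k - ζ l) • bv F {i,j,k,l} - (ζ k - ζ m) • bv F {i,j,k,m}
      + (ζ l - ζ m) • bv F {i,j,l,m} + (ζ l - ζ m) • av F {j,k,l,m}
  let v3 : Lam F :=
    -((ζ i - ζ l) • av F {i,j,k,l}) - (ζ j - ζ l) • bv F {i,j,k,l}
      + (ζ i - ζ m) • av F {i,j,k,m} + (ζ j - ζ m) • bv F {i,j,k,m}
      - (ζ l - ζ m) • bv F {i,k,l,m} + (ζ l - ζ m) • bv F {j,k,l,m}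
  ![v1, v2, v3,
    (ζ m - ζ l)⁻¹ • ((ζ i - ζ m) • v1 + (ζ j - ζ m) • v2 + (ζ k - ζ m) • v3),
    (ζ l - ζ m)⁻¹ • ((ζ i - ζ l) • v1 + (ζ j - ζ l) • v2 + (ζ k - ζ l) • v3)]

/-- Deformed weight `W̃_u = W_u + ε_u Σ_p x_{u,p} v_{u,p}`. -/
def Wt (eps : ℤ) (i j k l m : Fin 6) (x : Fin 5 → F) : Lam F :=
  (ζ l - ζ m)⁻¹ • (vv F ζ i j k l m 0 * vv F ζ i j k l m 1 * vv F ζ i j k l m 2)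
    + (eps : F) • ∑ p : Fin 5, x p • vv F ζ i j k l m p

/-- The left-hand-side expression `L(X)` of the deformed 3→3 relation, for an x-chain
`X = (x₁, x₂, x₃)` on the 4-simplices `12345`, `12346`, `12356` (0-indexed), with
`ε₁₂₃₄₅ = 1`, `ε₁₂₃₄₆ = −1`, `ε₁₂₃₅₆ = 1` and `w₁₂₃ = ζ₂₃⁻¹ζ₃₄ a₁₂₃₄`. -/
def L (x1 x2 x3 : Fin 5 → F) : Lam F :=
  ((ζ 2 - ζ 3) * (ζ 2 - ζ 4) * (ζ 2 - ζ 5))⁻¹ •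
    int2 F {0,1,2,5} (int2 F {0,1,2,4} (int2 F {0,1,2,3}
      (Wt F ζ 1 0 1 2 3 4 x1 * Wt F ζ (-1) 0 1 2 3 5 x2 * Wt F ζ 1 0 1 2 4 5 x3 *
        (((ζ 1 - ζ 2)⁻¹ * (ζ 2 - ζ 3)) • av F {0,1,2,3}))))

section helpers
variable {F}

theorem cl_mul (d : Module.Dual F ((Bool × Finset (Fin 6)) → F)) (x y : Lam F) :
    CliffordAlgebra.contractLeft d (x * y)
      = CliffordAlgebra.contractLeft d x * y
        + CliffordAlgebra.involute x * CliffordAlgebra.contractLeft d y := by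
  induction x using CliffordAlgebra.left_induction generalizing y with
  | algebraMap r =>
    simp [CliffordAlgebra.contractLeft_algebraMap_mul, CliffordAlgebra.contractLeft_algebraMap]
  | add x x' hx hx' => simp only [add_mul, map_add, hx, hx']; abel
  | ι_mul x m hx =>
    rw [mul_assoc, CliffordAlgebra.contractLeft_ι_mul, hx, CliffordAlgebra.contractLeft_ι_mul,
      map_mul, CliffordAlgebra.involute_ι]
    simp only [sub_mul, mul_add, smul_mul_assoc, mul_assoc, neg_mul]
    abel

theorem da_mul (t : Finset (Fin 6)) (x y : Lam F) :
    da F t (x * y) = da F t x * y + CliffordAlgebra.involute x * da F t y := cl_mul _ _ _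
theorem db_mul (t : Finset (Fin 6)) (x y : Lam F) :
    db F t (x * y) = db F t x * y + CliffordAlgebra.involute x * db F t y := cl_mul _ _ _

theorem da_av (t s : Finset (Fin 6)) : da F t (av F s) = if t = s then 1 else 0 := by
  simp only [da, av, ExteriorAlgebra.ι]
  rw [CliffordAlgebra.contractLeft_ι]
  by_cases h : t = s <;> simp [h]
theorem db_bv (t s : Finset (Fin 6)) : db F t (bv F s) = if t = s then 1 else 0 := by
  simp only [db, bv, ExteriorAlgebra.ι]
  rw [CliffordAlgebra.contractLeft_ι]
  by_cases h : t = s <;> simp [h]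
theorem da_bv (t s : Finset (Fin 6)) : da F t (bv F s) = 0 := by
  simp only [da, bv, ExteriorAlgebra.ι]
  rw [CliffordAlgebra.contractLeft_ι]
  simp
theorem db_av (t s : Finset (Fin 6)) : db F t (av F s) = 0 := by
  simp only [db, av, ExteriorAlgebra.ι]
  rw [CliffordAlgebra.contractLeft_ι]
  simp

theorem inv_av (s : Finset (Fin 6)) : CliffordAlgebra.involute (av F s) = - av F s :=
  CliffordAlgebra.involute_ι _
theorem inv_bv (s : Finset (Fin 6)) : CliffordAlgebra.involute (bv F s) = - bv F s :=
  CliffordAlgebra.involute_ι _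

theorem inv_vv (i j k l m : Fin 6) (p : Fin 5) :
    CliffordAlgebra.involute (vv F ζ i j k l m p) = - vv F ζ i j k l m p := by
  fin_cases p <;> simp [vv, inv_av, inv_bv] <;> module

theorem inv_Wt (e : ℤ) (i j k l m : Fin 6) (x : Fin 5 → F) :
    CliffordAlgebra.involute (Wt F ζ e i j k l m x) = - Wt F ζ e i j k l m x := by
  simp only [Wt, map_add, map_smul, map_mul, map_sum, inv_vv]
  simp [Finset.sum_neg_distrib, add_comm]

theorem Wt_shift (e : ℤ) (i j k l m : Fin 6) (x : Fin 5 → F) (d : F) (p : Fin 5) :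
    Wt F ζ e i j k l m (x + d • (Pi.single p 1 : Fin 5 → F))
      = Wt F ζ e i j k l m x + ((e : F) * d) • vv F ζ i j k l m p := by
  have : ∑ q : Fin 5, (d * (Pi.single p 1 : Fin 5 → F) q) • vv F ζ i j k l m q
      = d • vv F ζ i j k l m p := by
    rw [Finset.sum_eq_single p]
    · simp
    · intro q _ hq; simp [hq]
    · simp
  simp only [Wt, Pi.add_apply, Pi.smul_apply, smul_eq_mul, add_smul, Finset.sum_add_distrib,
    this, smul_add]
  rw [mul_smul, add_assoc]

def Zt (t : Finset (Fin 6)) (x : Lam F) : Prop := da F t x = 0 ∧ db F t x = 0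

theorem Zt_mul {t : Finset (Fin 6)} {x y : Lam F} (hx : Zt t x) (hy : Zt t y) :
    Zt t (x * y) := by
  constructor
  · rw [da_mul, hx.1, hy.1]; simp
  · rw [db_mul, hx.2, hy.2]; simp

theorem Zt_one (t : Finset (Fin 6)) : Zt t (1 : Lam F) :=
  ⟨CliffordAlgebra.contractLeft_one _ _, CliffordAlgebra.contractLeft_one _ _⟩

theorem int2_mul_r {t : Finset (Fin 6)} (x : Lam F) {y : Lam F} (hy : Zt t y) :
    int2 F t (x * y) = int2 F t x * y := by
  simp [int2, da_mul, db_mul, hy.1, hy.2]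

theorem int2_mul_l {t : Finset (Fin 6)} {x : Lam F} (y : Lam F) (hx : Zt t x) :
    int2 F t (x * y) = x * int2 F t y := by
  have h : ∀ d : Module.Dual F ((Bool × Finset (Fin 6)) → F), ∀ z : Lam F,
      CliffordAlgebra.contractLeft d z = 0 →
      CliffordAlgebra.contractLeft d (CliffordAlgebra.involute z) = 0 := by
    intro d z hz
    have : ∀ z : Lam F, CliffordAlgebra.contractLeft d (CliffordAlgebra.involute z)
        = - CliffordAlgebra.involute (CliffordAlgebra.contractLeft d z) := by
      intro z
      induction z using CliffordAlgebra.left_induction with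
      | algebraMap r => simp [CliffordAlgebra.contractLeft_algebraMap]
      | add x y hx hy => simp only [map_add, hx, hy, neg_add]
      | ι_mul x m hx =>
        rw [map_mul, CliffordAlgebra.involute_ι, neg_mul, map_neg,
          CliffordAlgebra.contractLeft_ι_mul, hx, CliffordAlgebra.contractLeft_ι_mul]
        simp
    rw [this, hz]; simp
  have h2 : db F t (CliffordAlgebra.involute x) = 0 := h _ _ hx.2
  simp [int2, da_mul, db_mul, hx.1, h2]

theorem int2_add (t : Finset (Fin 6)) (x y : Lam F) :
    int2 F t (x + y) = int2 F t x + int2 F t y := by simp [int2]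
theorem int2_smul (t : Finset (Fin 6)) (c : F) (x : Lam F) :
    int2 F t (c • x) = c • int2 F t x := by simp [int2]

theorem int2_zero_of_Zt {t : Finset (Fin 6)} {x : Lam F} (hx : Zt t x) : int2 F t x = 0 := by
  simp [int2, hx.1]

theorem local_shift {t : Finset (Fin 6)} {P A M B Y v w : Lam F} {c c' e e' : F}
    (hP : Zt t P) (hM : Zt t M) (hY : Zt t Y) (hv : Zt t v) (hw : Zt t w)
    (hA : int2 F t A = c • v) (hB : int2 F t B = c' • w) (h : e * c' + e' * c = 0) :
    int2 F t (P * ((A + e • v) * (M * (B + e' • w))) * Y)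
      = int2 F t (P * (A * (M * B)) * Y) := by
  have h1 : (A + e • v) * (M * (B + e' • w))
      = A * (M * B) + (e' • (A * (M * w)) + (e • ((v * M) * B)) + (e * e') • (v * (M * w))) := by
    simp only [mul_add, add_mul, smul_mul_assoc, mul_smul_comm, mul_assoc, smul_smul, smul_add]
    module
  rw [int2_mul_r _ hY, int2_mul_r _ hY, int2_mul_l _ hP, int2_mul_l _ hP, h1, int2_add]
  congr 2
  rw [add_eq_left, int2_add, int2_add, int2_smul, int2_smul, int2_smul,
    int2_mul_r _ (Zt_mul hM hw), int2_mul_l _ (Zt_mul hv hM),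
    int2_zero_of_Zt (Zt_mul hv (Zt_mul hM hw)), hA, hB, smul_zero, add_zero,
    smul_mul_assoc, mul_smul_comm, mul_assoc, smul_smul, smul_smul, ← add_smul,
    add_comm, h, zero_smul]

theorem cl_sq (d : Module.Dual F ((Bool × Finset (Fin 6)) → F)) (x : Lam F) :
    CliffordAlgebra.contractLeft d (CliffordAlgebra.contractLeft d x) = 0 :=
  CliffordAlgebra.contractLeft_contractLeft _ _

theorem cl_comm (d d' : Module.Dual F ((Bool × Finset (Fin 6)) → F)) (x : Lam F) :
    CliffordAlgebra.contractLeft d (CliffordAlgebra.contractLeft d' x)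
      = - CliffordAlgebra.contractLeft d' (CliffordAlgebra.contractLeft d x) :=
  CliffordAlgebra.contractLeft_comm _ _ _

theorem int2_da (t s : Finset (Fin 6)) (x : Lam F) :
    int2 F t (da F s x) = da F s (int2 F t x) := by
  simp only [int2, da, db]
  rw [cl_comm _ (LinearMap.proj (false, s)), map_neg, cl_comm _ (LinearMap.proj (false, s)),
    neg_neg]
theorem int2_db (t s : Finset (Fin 6)) (x : Lam F) :
    int2 F t (db F s x) = db F s (int2 F t x) := by
  simp only [int2, da, db]
  rw [cl_comm _ (LinearMap.proj (true, s)), map_neg, cl_comm _ (LinearMap.proj (true, s)),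
    neg_neg]
theorem int2_comm (t s : Finset (Fin 6)) (x : Lam F) :
    int2 F t (int2 F s x) = int2 F s (int2 F t x) := by
  conv_lhs => rw [int2.eq_1 F s x, int2_db, int2_da]
  rfl
theorem int2_da_self (t : Finset (Fin 6)) (x : Lam F) : int2 F t (da F t x) = 0 := by
  simp only [int2, da]; rw [cl_sq, map_zero]
theorem int2_db_self (t : Finset (Fin 6)) (x : Lam F) : int2 F t (db F t x) = 0 := by
  rw [int2_db]; exact cl_sq _ _

/-- the total integral -/
def I3 (f : Lam F) : Lam F := int2 F {0,1,2,5} (int2 F {0,1,2,4} (int2 F {0,1,2,3} f))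

/-- `t`-part values on the `v`'s -/
theorem Wt_Zt {t : Finset (Fin 6)} {i j k l m : Fin 6} (h : ∀ p, Zt t (vv F ζ i j k l m p))
    (e : ℤ) (x : Fin 5 → F) : Zt t (Wt F ζ e i j k l m x) := by
  have h3 := Zt_mul (Zt_mul (h 0) (h 1)) (h 2)
  constructor
  · simp [Wt, h3.1, (h _).1]
  · simp [Wt, h3.2, (h _).2]

theorem J_l {t : Finset (Fin 6)} {i j k l m : Fin 6} (hlm : ζ l - ζ m ≠ 0)
    (a0 : da F t (vv F ζ i j k l m 0) = (ζ k - ζ l) • 1)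
    (a1 : da F t (vv F ζ i j k l m 1) = 0)
    (a2 : da F t (vv F ζ i j k l m 2) = -(ζ i - ζ l) • 1)
    (b0 : db F t (vv F ζ i j k l m 0) = 0)
    (b1 : db F t (vv F ζ i j k l m 1) = (ζ k - ζ l) • 1)
    (b2 : db F t (vv F ζ i j k l m 2) = -(ζ j - ζ l) • 1)
    (e : ℤ) (x : Fin 5 → F) :
    Zt t (vv F ζ i j k l m 4) ∧
      int2 F t (Wt F ζ e i j k l m x) = (ζ k - ζ l) • vv F ζ i j k l m 4 := by
  have v4 : vv F ζ i j k l m 4 = (ζ l - ζ m)⁻¹ • ((ζ i - ζ l) • vv F ζ i j k l m 0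
    + (ζ j - ζ l) • vv F ζ i j k l m 1 + (ζ k - ζ l) • vv F ζ i j k l m 2) := rfl
  have v3 : vv F ζ i j k l m 3 = (ζ m - ζ l)⁻¹ • ((ζ i - ζ m) • vv F ζ i j k l m 0
    + (ζ j - ζ m) • vv F ζ i j k l m 1 + (ζ k - ζ m) • vv F ζ i j k l m 2) := rfl
  have o : db F t 1 = 0 := (Zt_one t).2
  refine ⟨⟨?_, ?_⟩, ?_⟩
  · rw [v4]; simp only [map_smul, map_add, a0, a1, a2]; module
  · rw [v4]; simp only [map_smul, map_add, b0, b1, b2]; module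
  · simp only [Wt, int2, map_add, map_smul, map_sum, Fin.sum_univ_five, v3, v4, da_mul, db_mul,
      inv_vv, a0, a1, a2, b0, b1, b2, o, map_zero, smul_zero, map_mul, map_neg, mul_zero,
      add_zero, zero_add, smul_mul_assoc, mul_smul_comm, one_mul, mul_one, zero_mul, map_one,
      neg_mul, mul_neg, neg_neg, smul_neg]
    module

theorem J_m {t : Finset (Fin 6)} {i j k l m : Fin 6} (hlm : ζ l - ζ m ≠ 0)
    (a0 : da F t (vv F ζ i j k l m 0) = -(ζ k - ζ m) • 1)
    (a1 : da F t (vv F ζ i j k l m 1) = 0)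
    (a2 : da F t (vv F ζ i j k l m 2) = (ζ i - ζ m) • 1)
    (b0 : db F t (vv F ζ i j k l m 0) = 0)
    (b1 : db F t (vv F ζ i j k l m 1) = -(ζ k - ζ m) • 1)
    (b2 : db F t (vv F ζ i j k l m 2) = (ζ j - ζ m) • 1)
    (e : ℤ) (x : Fin 5 → F) :
    Zt t (vv F ζ i j k l m 3) ∧
      int2 F t (Wt F ζ e i j k l m x) = (-(ζ k - ζ m)) • vv F ζ i j k l m 3 := by
  have v4 : vv F ζ i j k l m 4 = (ζ l - ζ m)⁻¹ • ((ζ i - ζ l) • vv F ζ i j k l m 0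
    + (ζ j - ζ l) • vv F ζ i j k l m 1 + (ζ k - ζ l) • vv F ζ i j k l m 2) := rfl
  have v3 : vv F ζ i j k l m 3 = (ζ m - ζ l)⁻¹ • ((ζ i - ζ m) • vv F ζ i j k l m 0
    + (ζ j - ζ m) • vv F ζ i j k l m 1 + (ζ k - ζ m) • vv F ζ i j k l m 2) := rfl
  have o : db F t 1 = 0 := (Zt_one t).2
  have hi : (ζ m - ζ l)⁻¹ = -(ζ l - ζ m)⁻¹ := by rw [← inv_neg, neg_sub]
  refine ⟨⟨?_, ?_⟩, ?_⟩
  · rw [v3]; simp only [map_smul, map_add, a0, a1, a2]; module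
  · rw [v3]; simp only [map_smul, map_add, b0, b1, b2]; module
  · simp only [Wt, int2, map_add, map_smul, map_sum, Fin.sum_univ_five, v3, v4, da_mul, db_mul,
      inv_vv, a0, a1, a2, b0, b1, b2, o, map_zero, smul_zero, map_mul, map_neg, mul_zero,
      add_zero, zero_add, smul_mul_assoc, mul_smul_comm, one_mul, mul_one, zero_mul, map_one, hi,
      neg_mul, mul_neg, neg_neg, smul_neg]
    module

/-- The common symmetry of the three simplices. -/
def DD (x : Lam F) : Lam F :=
  (ζ 2 - ζ 3)⁻¹ • ((ζ 1 - ζ 2) • da F {0,1,2,3} x - (ζ 0 - ζ 2) • db F {0,1,2,3} x)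
  + (ζ 2 - ζ 4)⁻¹ • ((ζ 1 - ζ 2) • da F {0,1,2,4} x - (ζ 0 - ζ 2) • db F {0,1,2,4} x)
  + (ζ 2 - ζ 5)⁻¹ • ((ζ 1 - ζ 2) • da F {0,1,2,5} x - (ζ 0 - ζ 2) • db F {0,1,2,5} x)

theorem DD_mul (x y : Lam F) :
    DD ζ (x * y) = DD ζ x * y + CliffordAlgebra.involute x * DD ζ y := by
  simp only [DD, da_mul, db_mul, add_mul, sub_mul, mul_add, mul_sub, smul_mul_assoc,
    mul_smul_comm]
  module

theorem DD_add (x y : Lam F) : DD ζ (x + y) = DD ζ x + DD ζ y := by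
  simp only [DD, map_add]; module
theorem DD_smul (c : F) (x : Lam F) : DD ζ (c • x) = c • DD ζ x := by
  simp only [DD, map_smul]; module

theorem I3_DD (x : Lam F) : I3 (DD ζ x) = 0 := by
  have z : ∀ t, int2 F t 0 = 0 := fun t => by simp [int2]
  have hs : ∀ t x y, int2 F t (x - y) = int2 F t x - int2 F t y := fun t x y => by simp [int2]
  simp [I3, DD, int2_add, hs, int2_smul, int2_da_self, int2_db_self, z, int2_da, int2_db]

theorem DD_Wt {i j k l m : Fin 6} (h0 : DD ζ (vv F ζ i j k l m 0) = 0)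
    (h1 : DD ζ (vv F ζ i j k l m 1) = 0) (h2 : DD ζ (vv F ζ i j k l m 2) = 0)
    (e : ℤ) (x : Fin 5 → F) : DD ζ (Wt F ζ e i j k l m x) = 0 := by
  have v4 : vv F ζ i j k l m 4 = (ζ l - ζ m)⁻¹ • ((ζ i - ζ l) • vv F ζ i j k l m 0
    + (ζ j - ζ l) • vv F ζ i j k l m 1 + (ζ k - ζ l) • vv F ζ i j k l m 2) := rfl
  have v3 : vv F ζ i j k l m 3 = (ζ m - ζ l)⁻¹ • ((ζ i - ζ m) • vv F ζ i j k l m 0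
    + (ζ j - ζ m) • vv F ζ i j k l m 1 + (ζ k - ζ m) • vv F ζ i j k l m 2) := rfl
  simp [Wt, Fin.sum_univ_five, v3, v4, DD_add, DD_smul, DD_mul, h0, h1, h2]

theorem zsub {ζ : Fin 6 → F} (hζ : Function.Injective ζ) {i j : Fin 6} (h : i ≠ j) :
    ζ i - ζ j ≠ 0 := sub_ne_zero.mpr fun e => h (hζ e)

theorem DD_W1 {ζ : Fin 6 → F} (hζ : Function.Injective ζ) (e : ℤ) (x : Fin 5 → F) :
    DD ζ (Wt F ζ e 0 1 2 3 4 x) = 0 := by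
  have h3 : ζ 2 - ζ 3 ≠ 0 := zsub hζ (by decide)
  have h4 : ζ 2 - ζ 4 ≠ 0 := zsub hζ (by decide)
  apply DD_Wt
  all_goals
    simp +decide [DD, vv, da_av, da_bv, db_av, db_bv]
    match_scalars
    field_simp
    ring

theorem DD_W2 {ζ : Fin 6 → F} (hζ : Function.Injective ζ) (e : ℤ) (x : Fin 5 → F) :
    DD ζ (Wt F ζ e 0 1 2 3 5 x) = 0 := by
  have h3 : ζ 2 - ζ 3 ≠ 0 := zsub hζ (by decide)
  have h4 : ζ 2 - ζ 5 ≠ 0 := zsub hζ (by decide)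
  apply DD_Wt
  all_goals
    simp +decide [DD, vv, da_av, da_bv, db_av, db_bv]
    match_scalars
    field_simp
    ring

theorem DD_W3 {ζ : Fin 6 → F} (hζ : Function.Injective ζ) (e : ℤ) (x : Fin 5 → F) :
    DD ζ (Wt F ζ e 0 1 2 4 5 x) = 0 := by
  have h3 : ζ 2 - ζ 4 ≠ 0 := zsub hζ (by decide)
  have h4 : ζ 2 - ζ 5 ≠ 0 := zsub hζ (by decide)
  apply DD_Wt
  all_goals
    simp +decide [DD, vv, da_av, da_bv, db_av, db_bv]
    match_scalars
    field_simp
    ring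

theorem I3_smul (c : F) (x : Lam F) : I3 (c • x) = c • I3 x := by simp [I3, int2_smul]
theorem I3_add (x y : Lam F) : I3 (x + y) = I3 x + I3 y := by simp [I3, int2_add]

theorem swap {ζ : Fin 6 → F} (hζ : Function.Injective ζ) (Φ : Lam F) (hΦ : DD ζ Φ = 0)
    (hi : CliffordAlgebra.involute Φ = - Φ) :
    I3 (Φ * av F {0,1,2,3}) = ((ζ 2 - ζ 4) * (ζ 2 - ζ 3)⁻¹) • I3 (Φ * av F {0,1,2,4}) := by
  have h3 : ζ 2 - ζ 3 ≠ 0 := zsub hζ (by decide)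
  have h4 : ζ 2 - ζ 4 ≠ 0 := zsub hζ (by decide)
  have h1 : ζ 1 - ζ 2 ≠ 0 := zsub hζ (by decide)
  have key := I3_DD ζ (Φ * (av F {0,1,2,3} * av F {0,1,2,4}))
  have e : DD ζ (Φ * (av F {0,1,2,3} * av F {0,1,2,4}))
      = (-((ζ 2 - ζ 3)⁻¹ * (ζ 1 - ζ 2))) • (Φ * av F {0,1,2,4})
        + ((ζ 2 - ζ 4)⁻¹ * (ζ 1 - ζ 2)) • (Φ * av F {0,1,2,3}) := by
    have e3 : DD ζ (av F {0,1,2,3}) = ((ζ 2 - ζ 3)⁻¹ * (ζ 1 - ζ 2)) • 1 := by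
      simp +decide [DD, da_av, db_av, smul_smul]
    have e4 : DD ζ (av F {0,1,2,4}) = ((ζ 2 - ζ 4)⁻¹ * (ζ 1 - ζ 2)) • 1 := by
      simp +decide [DD, da_av, db_av, smul_smul]
    rw [DD_mul, hΦ, hi, DD_mul, e3, e4, inv_av]
    simp only [zero_mul, zero_add, smul_mul_assoc, mul_smul_comm, one_mul, mul_one, mul_add,
      neg_mul, mul_neg, smul_neg, neg_neg]
    module
  rw [e, I3_add, I3_smul, I3_smul] at key
  have k2 : ((ζ 2 - ζ 4)⁻¹ * (ζ 1 - ζ 2)) • I3 (Φ * av F {0,1,2,3})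
      = ((ζ 2 - ζ 3)⁻¹ * (ζ 1 - ζ 2)) • I3 (Φ * av F {0,1,2,4}) := by
    rw [← sub_eq_zero, ← key]; module
  have k3 := congrArg (fun z => ((ζ 2 - ζ 4) * (ζ 1 - ζ 2)⁻¹) • z) k2
  simp only [smul_smul] at k3
  rw [show (ζ 2 - ζ 4) * (ζ 1 - ζ 2)⁻¹ * ((ζ 2 - ζ 4)⁻¹ * (ζ 1 - ζ 2)) = 1 by field_simp,
    one_smul] at k3
  rw [k3]
  congr 1
  field_simp

theorem L_eq (x1 x2 x3 : Fin 5 → F) :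
    L F ζ x1 x2 x3 = (((ζ 2 - ζ 3) * (ζ 2 - ζ 4) * (ζ 2 - ζ 5))⁻¹
      * ((ζ 1 - ζ 2)⁻¹ * (ζ 2 - ζ 3))) •
      I3 (Wt F ζ 1 0 1 2 3 4 x1 * Wt F ζ (-1) 0 1 2 3 5 x2 * Wt F ζ 1 0 1 2 4 5 x3
        * av F {0,1,2,3}) := by
  rw [L, mul_smul _ _ (I3 _), ← I3_smul, ← mul_smul_comm]; rfl

theorem L_eq' {ζ : Fin 6 → F} (hζ : Function.Injective ζ) (x1 x2 x3 : Fin 5 → F) :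
    L F ζ x1 x2 x3 = (((ζ 2 - ζ 3) * (ζ 2 - ζ 4) * (ζ 2 - ζ 5))⁻¹
      * ((ζ 1 - ζ 2)⁻¹ * (ζ 2 - ζ 3))) • ((ζ 2 - ζ 4) * (ζ 2 - ζ 3)⁻¹) •
      I3 (Wt F ζ 1 0 1 2 3 4 x1 * Wt F ζ (-1) 0 1 2 3 5 x2 * Wt F ζ 1 0 1 2 4 5 x3
        * av F {0,1,2,4}) := by
  rw [L_eq, swap hζ]
  · simp [DD_mul, DD_W1 hζ, DD_W2 hζ, DD_W3 hζ]
  · simp [inv_Wt]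

theorem shift1 {ζ : Fin 6 → F} (hζ : Function.Injective ζ) (x1 x2 x3 : Fin 5 → F) (d : F) :
    L F ζ (x1 + d • (Pi.single 4 1 : Fin 5 → F)) (x2 + d • (Pi.single 4 1 : Fin 5 → F)) x3
      = L F ζ x1 x2 x3 := by
  have A := fun e x => J_l (t := {0,1,2,3}) (i := 0) (j := 1) (k := 2) (l := 3) (m := 4) ζ
    (zsub hζ (by decide))
    (by simp +decide [vv, da_av, da_bv, -neg_sub]) (by simp +decide [vv, da_av, da_bv, -neg_sub])
    (by simp +decide [vv, da_av, da_bv, -neg_sub]) (by simp +decide [vv, db_av, db_bv, -neg_sub])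
    (by simp +decide [vv, db_av, db_bv, -neg_sub]) (by simp +decide [vv, db_av, db_bv, -neg_sub]) e x
  have B := fun e x => J_l (t := {0,1,2,3}) (i := 0) (j := 1) (k := 2) (l := 3) (m := 5) ζ
    (zsub hζ (by decide))
    (by simp +decide [vv, da_av, da_bv, -neg_sub]) (by simp +decide [vv, da_av, da_bv, -neg_sub])
    (by simp +decide [vv, da_av, da_bv, -neg_sub]) (by simp +decide [vv, db_av, db_bv, -neg_sub])
    (by simp +decide [vv, db_av, db_bv, -neg_sub]) (by simp +decide [vv, db_av, db_bv, -neg_sub]) e x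
  have C : ∀ p, Zt {0,1,2,3} (vv F ζ 0 1 2 4 5 p) := by
    intro p
    constructor <;> fin_cases p <;> simp +decide [vv, da_av, da_bv, db_av, db_bv]
  have hY : Zt {0,1,2,3} (Wt F ζ 1 0 1 2 4 5 x3 * av F {0,1,2,4}) :=
    Zt_mul (Wt_Zt ζ C _ _) ⟨by simp +decide [da_av], by simp [db_av]⟩
  have main := local_shift (e := ((1 : ℤ) : F) * d) (e' := ((-1 : ℤ) : F) * d)
    (Zt_one _) (Zt_one _) hY (A 1 x1).1 (B (-1) x2).1
    (A 1 x1).2 (B (-1) x2).2 (by push_cast; ring)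
  rw [L_eq' hζ, L_eq' hζ, Wt_shift, Wt_shift]
  simp only [one_mul, ← mul_assoc] at main
  simp only [I3]
  rw [main]

theorem shift2 {ζ : Fin 6 → F} (hζ : Function.Injective ζ) (x1 x2 x3 : Fin 5 → F) (d : F) :
    L F ζ (x1 + d • (Pi.single 3 1 : Fin 5 → F)) x2 (x3 + d • (Pi.single 4 1 : Fin 5 → F))
      = L F ζ x1 x2 x3 := by
  have A := fun e x => J_m (t := {0,1,2,4}) (i := 0) (j := 1) (k := 2) (l := 3) (m := 4) ζ
    (zsub hζ (by decide))
    (by simp +decide [vv, da_av, da_bv, -neg_sub]) (by simp +decide [vv, da_av, da_bv, -neg_sub])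
    (by simp +decide [vv, da_av, da_bv, -neg_sub]) (by simp +decide [vv, db_av, db_bv, -neg_sub])
    (by simp +decide [vv, db_av, db_bv, -neg_sub]) (by simp +decide [vv, db_av, db_bv, -neg_sub]) e x
  have B := fun e x => J_l (t := {0,1,2,4}) (i := 0) (j := 1) (k := 2) (l := 4) (m := 5) ζ
    (zsub hζ (by decide))
    (by simp +decide [vv, da_av, da_bv, -neg_sub]) (by simp +decide [vv, da_av, da_bv, -neg_sub])
    (by simp +decide [vv, da_av, da_bv, -neg_sub]) (by simp +decide [vv, db_av, db_bv, -neg_sub])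
    (by simp +decide [vv, db_av, db_bv, -neg_sub]) (by simp +decide [vv, db_av, db_bv, -neg_sub]) e x
  have C : ∀ p, Zt {0,1,2,4} (vv F ζ 0 1 2 3 5 p) := by
    intro p
    constructor <;> fin_cases p <;> simp +decide [vv, da_av, da_bv, db_av, db_bv]
  have hY : Zt {0,1,2,4} (av F {0,1,2,3}) := ⟨by simp +decide [da_av], by simp [db_av]⟩
  have main := local_shift (e := ((1 : ℤ) : F) * d) (e' := ((1 : ℤ) : F) * d)
    (Zt_one _) (Wt_Zt ζ C (-1) x2) hY (A 1 x1).1 (B 1 x3).1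
    (A 1 x1).2 (B 1 x3).2 (by push_cast; ring)
  rw [L_eq, L_eq, Wt_shift, Wt_shift]
  simp only [one_mul, ← mul_assoc] at main
  simp only [I3]
  rw [int2_comm {0,1,2,4}, main, int2_comm {0,1,2,4}]

theorem shift3 {ζ : Fin 6 → F} (hζ : Function.Injective ζ) (x1 x2 x3 : Fin 5 → F) (d : F) :
    L F ζ x1 (x2 + d • (Pi.single 3 1 : Fin 5 → F)) (x3 + d • (Pi.single 3 1 : Fin 5 → F))
      = L F ζ x1 x2 x3 := by
  have A := fun e x => J_m (t := {0,1,2,5}) (i := 0) (j := 1) (k := 2) (l := 3) (m := 5) ζ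
    (zsub hζ (by decide))
    (by simp +decide [vv, da_av, da_bv, -neg_sub]) (by simp +decide [vv, da_av, da_bv, -neg_sub])
    (by simp +decide [vv, da_av, da_bv, -neg_sub]) (by simp +decide [vv, db_av, db_bv, -neg_sub])
    (by simp +decide [vv, db_av, db_bv, -neg_sub]) (by simp +decide [vv, db_av, db_bv, -neg_sub]) e x
  have B := fun e x => J_m (t := {0,1,2,5}) (i := 0) (j := 1) (k := 2) (l := 4) (m := 5) ζ
    (zsub hζ (by decide))
    (by simp +decide [vv, da_av, da_bv, -neg_sub]) (by simp +decide [vv, da_av, da_bv, -neg_sub])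
    (by simp +decide [vv, da_av, da_bv, -neg_sub]) (by simp +decide [vv, db_av, db_bv, -neg_sub])
    (by simp +decide [vv, db_av, db_bv, -neg_sub]) (by simp +decide [vv, db_av, db_bv, -neg_sub]) e x
  have C : ∀ p, Zt {0,1,2,5} (vv F ζ 0 1 2 3 4 p) := by
    intro p
    constructor <;> fin_cases p <;> simp +decide [vv, da_av, da_bv, db_av, db_bv]
  have hY : Zt {0,1,2,5} (av F {0,1,2,3}) := ⟨by simp +decide [da_av], by simp [db_av]⟩
  have main := local_shift (e := ((-1 : ℤ) : F) * d) (e' := ((1 : ℤ) : F) * d)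
    (Wt_Zt ζ C 1 x1) (Zt_one _) hY (A (-1) x2).1 (B 1 x3).1
    (A (-1) x2).2 (B 1 x3).2 (by push_cast; ring)
  rw [L_eq, L_eq, Wt_shift, Wt_shift]
  simp only [one_mul, ← mul_assoc] at main
  simp only [I3]
  rw [int2_comm {0,1,2,5}, int2_comm {0,1,2,5} {0,1,2,3}, main,
    int2_comm {0,1,2,5}, int2_comm {0,1,2,5} {0,1,2,3}]

end helpers

/-- Theorem 5 of the paper (one side): `L(X)` is unchanged when a boundary x-chain is
added to `X`. A boundary x-chain is the image under `g₃` of a chain `d₁ e₁₂₃₄ + d₂ e₁₂₃₅ +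
d₃ e₁₂₃₆` of the inner tetrahedra: `g₃(e_t) = e_{u,m} + e_{u',m'}` for the two 4-simplices
`u = t ∪ {m}`, `u' = t ∪ {m'}` containing `t`. -/
theorem L_invariant_under_boundary (hchar : (2 : F) ≠ 0) (hζ : Function.Injective ζ)
    (x1 x2 x3 : Fin 5 → F) (d1 d2 d3 : F) :
    L F ζ (x1 + d1 • (Pi.single 4 1 : Fin 5 → F) + d2 • (Pi.single 3 1 : Fin 5 → F))
        (x2 + d1 • (Pi.single 4 1 : Fin 5 → F) + d3 • (Pi.single 3 1 : Fin 5 → F))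
        (x3 + d2 • (Pi.single 4 1 : Fin 5 → F) + d3 • (Pi.single 3 1 : Fin 5 → F))
      = L F ζ x1 x2 x3 := by
  rw [shift3 hζ, shift2 hζ, shift1 hζ]


end
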